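/- arXiv:2604.15698 — 3 statements merged into one kernel-verified Lean document; each statement's English description precedes it below -/
import Mathlib

section
/- Let A := Atom(S_O) be the output of the deletion procedure. Then (i) Cn(A) = Cn(S_O), and (ii) for every a ∈ A one has a ∉ Cn(A \ {a}) (irredundancy). -/
open scoped BigOperators Classical

noncomputable section

variable {𝕊 : Type*} [Fintype 𝕊]

/-- One step of the deletion procedure: delete `s` from the current set `A`
if `s` is derivable from the rest. -/
def atomStep (Cn : Set 𝕊 → Set 𝕊) (A : Set 𝕊) (s : 𝕊) : Set 𝕊 :=
  if s ∈ Cn (A \ {s}) then A \ {s} else A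

/-- The deletion procedure: scan the canonical list `L`, deleting redundant
elements; `Atom(S_O) = atomCore Cn S_O L`. -/
def atomCore (Cn : Set 𝕊 → Set 𝕊) (S : Set 𝕊) (L : List 𝕊) : Set 𝕊 :=
  L.foldl (atomStep Cn) S

/-- A deletion step only removes elements. -/
theorem atomStep_subset {α : Type*} (Cn : Set α → Set α) (A : Set α) (s : α) :
    atomStep Cn A s ⊆ A := by
  unfold atomStep
  split_ifs
  · exact Set.sdiff_subset
  · exact subset_rfl

/-- The deletion procedure only removes elements. -/
theorem atomCore_subset {α : Type*} (Cn : Set α → Set α) (S : Set α) (L : List α) :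
    atomCore Cn S L ⊆ S := by
  induction L generalizing S with
  | nil => exact subset_rfl
  | cons s L ih => exact (ih (atomStep Cn S s)).trans (atomStep_subset Cn S s)

/-- A deletion step does not change the closure. -/
theorem closure_atomStep {α : Type*} {Cn : Set α → Set α} (hrefl : ∀ Γ : Set α, Γ ⊆ Cn Γ)
    (hmono : ∀ Γ Γ' : Set α, Γ ⊆ Γ' → Cn Γ ⊆ Cn Γ') (hidem : ∀ Γ : Set α, Cn (Cn Γ) = Cn Γ)
    (A : Set α) (s : α) : Cn (atomStep Cn A s) = Cn A := by
  refine (hmono _ _ (atomStep_subset Cn A s)).antisymm ?_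
  rw [← hidem (atomStep Cn A s)]
  refine hmono _ _ fun x hx => ?_
  unfold atomStep
  split_ifs with h
  · by_cases hxs : x = s
    · exact hxs ▸ h
    · exact hrefl _ ⟨hx, hxs⟩
  · exact hrefl _ hx

/-- The deletion procedure does not change the closure. -/
theorem closure_atomCore {α : Type*} {Cn : Set α → Set α} (hrefl : ∀ Γ : Set α, Γ ⊆ Cn Γ)
    (hmono : ∀ Γ Γ' : Set α, Γ ⊆ Γ' → Cn Γ ⊆ Cn Γ') (hidem : ∀ Γ : Set α, Cn (Cn Γ) = Cn Γ)
    (S : Set α) (L : List α) : Cn (atomCore Cn S L) = Cn S := by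
  induction L generalizing S with
  | nil => rfl
  | cons s L ih => exact (ih (atomStep Cn S s)).trans (closure_atomStep hrefl hmono hidem S s)

/-- A scanned element that survives the deletion procedure is not derivable from the other
survivors. -/
theorem notMem_closure_atomCore_diff {α : Type*} {Cn : Set α → Set α}
    (hmono : ∀ Γ Γ' : Set α, Γ ⊆ Γ' → Cn Γ ⊆ Cn Γ') (S : Set α) {L : List α} {a : α}
    (haL : a ∈ L) (ha : a ∈ atomCore Cn S L) : a ∉ Cn (atomCore Cn S L \ {a}) := by
  induction L generalizing S with
  | nil => simp at haL
  | cons s L ih =>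
    rcases List.mem_cons.1 haL with rfl | haL
    · have hstep : a ∈ atomStep Cn S a := atomCore_subset Cn _ L ha
      have hS : a ∉ Cn (S \ {a}) := fun h => by simp [atomStep, h] at hstep
      exact fun h => hS (hmono _ _ (Set.sdiff_subset_sdiff_left (atomCore_subset Cn S _)) h)
    · exact ih (atomStep Cn S s) haL ha

/-- Core correctness: the output `A = Atom(S_O)` of the
deletion procedure satisfies (i) `Cn(A) = Cn(S_O)` and (ii) irredundancy:
`a ∉ Cn(A \ {a})` for every `a ∈ A`. -/
theorem atomCore_correct
    (Cn : Set 𝕊 → Set 𝕊)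
    (hrefl : ∀ Γ : Set 𝕊, Γ ⊆ Cn Γ)
    (hmono : ∀ Γ Γ' : Set 𝕊, Γ ⊆ Γ' → Cn Γ ⊆ Cn Γ')
    (hidem : ∀ Γ : Set 𝕊, Cn (Cn Γ) = Cn Γ)
    (S_O : Set 𝕊) (L : List 𝕊)
    (hnodup : L.Nodup)
    (henum : ∀ s : 𝕊, s ∈ L ↔ s ∈ S_O) :
    Cn (atomCore Cn S_O L) = Cn S_O ∧
      ∀ a ∈ atomCore Cn S_O L, a ∉ Cn (atomCore Cn S_O L \ {a}) := by
  exact ⟨closure_atomCore hrefl hmono hidem S_O L, fun a ha =>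
    notMem_closure_atomCore_diff hmono S_O ((henum a).2 (atomCore_subset Cn S_O L ha)) ha⟩

end
end

section
/- Assume additionally that Cn(B) = ⋃_{n≥0} T^n(B) for every B ⊆ 𝕊, and that Atom(S_O) = Ess(S_O), where Ess(S_O) := {s ∈ S_O : s ∉ Cn(S_O \ {s})}. Let A := Atom(S_O), let Dd(q | B) denote the least n ≥ 0 with q ∈ T^n(B) (∞ if none), and let D_d := max over q ∈ S_O of Dd(q | A) (with max over the empty set := 0). Then A_δ = A for every δ ≥ D_d. -/
open scoped BigOperators Classical

noncomputable section

variable {𝕊 : Type*} [Fintype 𝕊]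

/-- The essential set `Ess(S_O) := {s ∈ S_O : s ∉ Cn(S_O \ {s})}`. -/
def essSet (Cn : Set 𝕊 → Set 𝕊) (S : Set 𝕊) : Set 𝕊 :=
  {s ∈ S | s ∉ Cn (S \ {s})}

/-- The δ-irredundant core `A_δ := {s ∈ S_O : s ∉ T^δ(S_O \ {s})}`. -/
def deltaCore (T : Set 𝕊 → Set 𝕊) (S : Set 𝕊) (δ : ℕ) : Set 𝕊 :=
  {s ∈ S | s ∉ T^[δ] (S \ {s})}

/-- The derivation depth `Dd(q | B)`: the least `n ≥ 0` with `q ∈ T^n(B)`,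
and `∞` if there is no such `n`. -/
def derivDepth (T : Set 𝕊 → Set 𝕊) (q : 𝕊) (B : Set 𝕊) : ℕ∞ :=
  ⨅ n ∈ {n : ℕ | q ∈ T^[n] B}, (n : ℕ∞)

/-- The maximum intrinsic derivation depth `D_d := max_{q ∈ S_O} Dd(q | A)`
(with `max ∅ := 0`). -/
def maxDepth (T : Set 𝕊 → Set 𝕊) (S A : Set 𝕊) : ℕ∞ :=
  ⨆ q ∈ S, derivDepth T q A

theorem monotone_iterate_of_inflationary {α : Type*} {T : Set α → Set α}
    (hinfl : ∀ B : Set α, B ⊆ T B) (B : Set α) : Monotone fun n : ℕ => T^[n] B :=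
  monotone_nat_of_le_succ fun n => by
    rw [Function.iterate_succ_apply']
    exact hinfl _

theorem mem_iterate_of_derivDepth_le {α : Type*} {T : Set α → Set α}
    (hinfl : ∀ B : Set α, B ⊆ T B) {q : α} {B : Set α} {δ : ℕ}
    (h : derivDepth T q B ≤ (δ : ℕ∞)) : q ∈ T^[δ] B := by
  by_contra hq
  have hlt : ((δ + 1 : ℕ) : ℕ∞) ≤ derivDepth T q B := by
    refine le_iInf₂ fun n hn => ?_
    rw [Nat.cast_le, Nat.succ_le_iff]
    by_contra! hle
    exact hq (monotone_iterate_of_inflationary hinfl B hle hn)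
  have := Nat.cast_le.mp (hlt.trans h)
  omega

/-- Stabilization of the δ-core filtration: assuming
`Cn(B) = ⋃ₙ T^n(B)` and `Atom(S_O) = Ess(S_O)`, one has `A_δ = A` for every
`δ ≥ D_d`, where `A := Atom(S_O)` and `D_d` is the maximum intrinsic
derivation depth. -/
theorem deltaCore_stabilizes
    (Cn : Set 𝕊 → Set 𝕊)
    (hrefl : ∀ Γ : Set 𝕊, Γ ⊆ Cn Γ)
    (hmono : ∀ Γ Γ' : Set 𝕊, Γ ⊆ Γ' → Cn Γ ⊆ Cn Γ')
    (hidem : ∀ Γ : Set 𝕊, Cn (Cn Γ) = Cn Γ)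
    (T : Set 𝕊 → Set 𝕊)
    (hinfl : ∀ B : Set 𝕊, B ⊆ T B)
    (hTmono : ∀ B B' : Set 𝕊, B ⊆ B' → T B ⊆ T B')
    (hCnT : ∀ B : Set 𝕊, Cn B = ⋃ n : ℕ, T^[n] B)
    (S_O : Set 𝕊) (L : List 𝕊)
    (hnodup : L.Nodup)
    (henum : ∀ s : 𝕊, s ∈ L ↔ s ∈ S_O)
    (hAtomEss : atomCore Cn S_O L = essSet Cn S_O) :
    ∀ δ : ℕ, maxDepth T S_O (atomCore Cn S_O L) ≤ (δ : ℕ∞) →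
      deltaCore T S_O δ = atomCore Cn S_O L := by
  intro δ hδ
  ext s
  constructor
  · rintro ⟨hs, hns⟩
    by_contra hsA
    have hsub : atomCore Cn S_O L ⊆ S_O \ {s} := fun x hx =>
      ⟨(hAtomEss ▸ hx : x ∈ essSet Cn S_O).1, fun hxs => hsA (hxs ▸ hx)⟩
    have hmonoT : Monotone T := fun B B' h => hTmono B B' h
    exact hns (hmonoT.iterate δ hsub
      (mem_iterate_of_derivDepth_le hinfl
        ((le_iSup₂ (f := fun q _ => derivDepth T q (atomCore Cn S_O L)) s hs).trans hδ)))
  · intro hs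
    rw [hAtomEss] at hs
    refine ⟨hs.1, fun h => hs.2 ?_⟩
    rw [hCnT]
    exact Set.mem_iUnion.mpr ⟨δ, h⟩

end
end

section
/- Assume A ≠ ∅ and core coverage: either P_A = 0 and Ŝ_O ∩ Cn(S_O) ≠ ∅, or P_A > 0 and R_Cn(a) ≠ ∅ for every a ∈ A. Define the core zero-distortion hypergraph Γ_0 := {W ⊆ A : W ≠ ∅ and ⋂_{a∈W} R_Cn(a) ≠ ∅}, and the hypergraph entropy H_{Γ_0}(π_A) as the infimum of I(π_A, K) over all test channels K from A to the finite set of nonempty subsets of A such that for every a ∈ A with π_A(a) > 0 and every subset w with K(w|a) > 0 one has a ∈ w and w ∈ Γ_0. Then R_sem(0) = P_A·H_{Γ_0}(π_A), with the convention that the right-hand side is 0 when P_A = 0. -/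
open scoped BigOperators Classical

noncomputable section

variable {𝕊 : Type*} [Fintype 𝕊]

/-- Shannon entropy of a probability vector on a finite type
(natural logarithm; `Real.log 0 = 0` handles the `0·log 0 := 0` convention). -/
def entropy {X : Type*} [Fintype X] (p : X → ℝ) : ℝ :=
  -∑ x, p x * Real.log (p x)

/-- Mutual information `I(p,W) := H(p) + H(q̂) − H(q)` of a source `p` and a
channel `W`, where `q(x,y) = p(x)·W(y|x)` and `q̂` is the output marginal. -/
def mutualInfo {X Y : Type*} [Fintype X] [Fintype Y]
    (p : X → ℝ) (W : X → Y → ℝ) : ℝ :=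
  entropy p + entropy (fun y => ∑ x, p x * W x y)
    - entropy (fun z : X × Y => p z.1 * W z.1 z.2)

/-- A test channel into the alphabet `Yset`: rows are probability vectors
supported inside `Yset`. -/
def IsChannel {X Y : Type*} [Fintype Y] (W : X → Y → ℝ) (Yset : Set Y) : Prop :=
  (∀ x y, 0 ≤ W x y) ∧ (∀ x, ∑ y, W x y = 1) ∧ (∀ x y, W x y ≠ 0 → y ∈ Yset)

/-- A probability vector supported on `S`. -/
def IsProbVector {X : Type*} [Fintype X] (p : X → ℝ) (S : Set X) : Prop :=
  (∀ x, 0 ≤ p x) ∧ (∑ x, p x = 1) ∧ (∀ x, p x ≠ 0 → x ∈ S)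

/-- The probability mass `p(A)` of a set `A`. -/
def massOn {X : Type*} [Fintype X] (p : X → ℝ) (A : Set X) : ℝ :=
  ∑ x, if x ∈ A then p x else 0

/-- The conditional distribution of `p` given `A`. -/
def condOn {X : Type*} [Fintype X] (p : X → ℝ) (A : Set X) : X → ℝ :=
  fun x => if x ∈ A then p x / massOn p A else 0

/-- Zero-distortion reconstruction set
`R_Cn(s) := {shat ∈ Shat_O : Cn((S_O \ {s}) ∪ {shat}) = Cn(S_O)}`. -/
def RCn (Cn : Set 𝕊 → Set 𝕊) (S_O Shat_O : Set 𝕊) (s : 𝕊) : Set 𝕊 :=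
  {shat ∈ Shat_O | Cn ((S_O \ {s}) ∪ {shat}) = Cn S_O}

/-- The channel `W` achieves zero closure distortion for the source `p`. -/
def ZeroClosureDist (Cn : Set 𝕊 → Set 𝕊) (S_O : Set 𝕊)
    (p : 𝕊 → ℝ) (W : 𝕊 → 𝕊 → ℝ) : Prop :=
  ∀ s : 𝕊, 0 < p s → ∀ shat : 𝕊, 0 < W s shat →
    Cn ((S_O \ {s}) ∪ {shat}) = Cn S_O

/-- `R_sem(0)`: the infimum of `I(p,W)` over all zero-closure-distortion test
channels from `S_O` to `Shat_O` (infimum of the empty set is `⊤ = +∞`). -/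
def RsemZero (Cn : Set 𝕊 → Set 𝕊) (S_O Shat_O : Set 𝕊) (p : 𝕊 → ℝ) : EReal :=
  sInf {r : EReal | ∃ W : 𝕊 → 𝕊 → ℝ, IsChannel W Shat_O ∧
    ZeroClosureDist Cn S_O p W ∧ r = ((mutualInfo p W : ℝ) : EReal)}

/-- The core zero-distortion hypergraph `Γ_0`: nonempty subsets `w ⊆ A` whose
members admit a common zero-distortion reconstruction. -/
def coreHypergraph (Cn : Set 𝕊 → Set 𝕊) (S_O Shat_O A : Set 𝕊) :
    Set (Finset 𝕊) :=
  {w | w.Nonempty ∧ ↑w ⊆ A ∧ ∃ shat : 𝕊, ∀ a ∈ w, shat ∈ RCn Cn S_O Shat_O a}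

/-- The hypergraph entropy `H_Γ(π)`: the infimum of `I(π, K)` over test
channels `K` from the core to nonempty subsets `w ⊆ A` such that, on the
support of `π`, every output `w` satisfies `a ∈ w` and `w ∈ Γ`. -/
def hypergraphEntropy (π : 𝕊 → ℝ) (A : Set 𝕊) (Γ : Set (Finset 𝕊)) : EReal :=
  sInf {r : EReal | ∃ K : 𝕊 → Finset 𝕊 → ℝ,
    IsChannel K {w : Finset 𝕊 | w.Nonempty ∧ ↑w ⊆ A} ∧
    (∀ a : 𝕊, 0 < π a → ∀ w : Finset 𝕊, 0 < K a w → a ∈ w ∧ w ∈ Γ) ∧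
    r = ((mutualInfo π K : ℝ) : EReal)}

section MutualInformation

variable {X Y Z : Type*} [Fintype X] [Fintype Y] [Fintype Z]

lemma entropy_eq_sum_negMulLog (p : X → ℝ) : entropy p = ∑ x, Real.negMulLog (p x) := by
  simp [entropy, Real.negMulLog]

lemma mutualInfo_eq (p : X → ℝ) (W : X → Y → ℝ) (hW : ∀ x, ∑ y, W x y = 1) :
    mutualInfo p W = ∑ y, Real.negMulLog (∑ x, p x * W x y)
      - ∑ x, p x * ∑ y, Real.negMulLog (W x y) := by
  have h : ∑ z : X × Y, Real.negMulLog (p z.1 * W z.1 z.2)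
      = ∑ x, Real.negMulLog (p x) + ∑ x, p x * ∑ y, Real.negMulLog (W x y) := by
    rw [Fintype.sum_prod_type, ← Finset.sum_add_distrib]
    refine Finset.sum_congr rfl fun x _ => ?_
    simp only [Real.negMulLog_mul]
    rw [Finset.sum_add_distrib, ← Finset.sum_mul, hW, one_mul, Finset.mul_sum]
  simp only [mutualInfo, entropy_eq_sum_negMulLog, h]
  ring

lemma mutualInfo_nonneg (p : X → ℝ) (W : X → Y → ℝ) (hp : ∀ x, 0 ≤ p x)
    (hp1 : ∑ x, p x = 1) (hW0 : ∀ x y, 0 ≤ W x y) (hW : ∀ x, ∑ y, W x y = 1) :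
    0 ≤ mutualInfo p W := by
  rw [mutualInfo_eq p W hW, sub_nonneg]
  simp only [Finset.mul_sum]
  rw [Finset.sum_comm]
  refine Finset.sum_le_sum fun y _ => ?_
  simpa using Real.concaveOn_negMulLog.le_map_sum (t := Finset.univ) (w := p)
    (p := fun x => W x y) (fun x _ => hp x) hp1 (fun x _ => hW0 x y)

lemma mutualInfo_const (p : X → ℝ) (r : Y → ℝ) (hp1 : ∑ x, p x = 1) (hr : ∑ y, r y = 1) :
    mutualInfo p (fun _ => r) = 0 := by
  rw [mutualInfo_eq _ _ fun _ => hr]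
  simp [← Finset.sum_mul, hp1]

/-- The output channel obtained by applying a deterministic map to the output of `W`. -/
def pushChannel (f : Y → Z) (W : X → Y → ℝ) (x : X) (z : Z) : ℝ :=
  ∑ y, if f y = z then W x y else 0

omit [Fintype X] [Fintype Z] in
lemma pushChannel_nonneg (f : Y → Z) {W : X → Y → ℝ} (hW0 : ∀ x y, 0 ≤ W x y) (x : X) (z : Z) :
    0 ≤ pushChannel f W x z :=
  Finset.sum_nonneg fun y _ => by split_ifs <;> simp [hW0]

omit [Fintype X] in
lemma sum_pushChannel (f : Y → Z) (W : X → Y → ℝ) (x : X) :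
    ∑ z, pushChannel f W x z = ∑ y, W x y := by
  unfold pushChannel
  rw [Finset.sum_comm]
  simp

omit [Fintype X] [Fintype Z] in
lemma exists_of_pushChannel_ne_zero {f : Y → Z} {W : X → Y → ℝ} {x : X} {z : Z}
    (h : pushChannel f W x z ≠ 0) : ∃ y, f y = z ∧ W x y ≠ 0 := by
  obtain ⟨y, -, hy⟩ := Finset.exists_ne_zero_of_sum_ne_zero h
  exact ⟨y, by simpa using hy⟩

lemma mul_log_le_of_dominated {v V q Q : ℝ} (hv : 0 ≤ v) (hvV : v ≤ V) (hq : 0 ≤ q) (hqQ : q ≤ Q)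
    (h : v ≠ 0 → q ≠ 0) :
    v * (Real.log q - Real.log Q - Real.log v + Real.log V) ≤ q * V / Q - v := by
  rcases eq_or_ne v 0 with rfl | hv'
  · simpa using div_nonneg (mul_nonneg hq hvV) (hq.trans hqQ)
  have hv0 : 0 < v := lt_of_le_of_ne hv hv'.symm
  have hV0 : 0 < V := hv0.trans_le hvV
  have hq0 : 0 < q := lt_of_le_of_ne hq (h hv').symm
  have hQ0 : 0 < Q := hq0.trans_le hqQ
  have hlog : Real.log (q * V / (Q * v))
      = Real.log q - Real.log Q - Real.log v + Real.log V := by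
    rw [Real.log_div (by positivity) (by positivity), Real.log_mul hq0.ne' hV0.ne',
      Real.log_mul hQ0.ne' hv0.ne']
    ring
  rw [← hlog]
  calc v * Real.log (q * V / (Q * v)) ≤ v * (q * V / (Q * v) - 1) :=
        mul_le_mul_of_nonneg_left (Real.log_le_sub_one_of_pos (by positivity)) hv
    _ = q * V / Q - v := by field_simp

lemma sum_fiber_mul (f : Y → Z) (v : Y → ℝ) (g : Z → ℝ) :
    ∑ z, (∑ y, if f y = z then v y else 0) * g z = ∑ y, v y * g (f y) := by
  simp only [Finset.sum_mul]
  rw [Finset.sum_comm]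
  simp [ite_mul]

omit [Fintype Z] in
lemma le_sum_fiber (f : Y → Z) {v : Y → ℝ} (hv : ∀ y, 0 ≤ v y) (y : Y) :
    v y ≤ ∑ y', if f y' = f y then v y' else 0 := by
  simpa using Finset.single_le_sum (f := fun y' => if f y' = f y then v y' else 0)
    (fun y' _ => by split_ifs <;> simp [hv]) (Finset.mem_univ y)

/-- Gibbs' inequality for the conditional laws of `v` and `q` given the fibres of `f`. -/
lemma sum_mul_log_fiber_le (f : Y → Z) {v q : Y → ℝ} (hv : ∀ y, 0 ≤ v y) (hq : ∀ y, 0 ≤ q y)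
    (h : ∀ y, v y ≠ 0 → q y ≠ 0) :
    ∑ y, v y * (Real.log (q y) - Real.log (∑ y', if f y' = f y then q y' else 0)
      - Real.log (v y) + Real.log (∑ y', if f y' = f y then v y' else 0)) ≤ 0 := by
  have hterm := Finset.sum_le_sum fun y (_ : y ∈ Finset.univ) =>
    mul_log_le_of_dominated (hv y) (le_sum_fiber f hv y) (hq y) (le_sum_fiber f hq y) (h y)
  refine hterm.trans ?_
  have hfib : ∑ y, q y * (∑ y', if f y' = f y then v y' else 0)
      / (∑ y', if f y' = f y then q y' else 0) ≤ ∑ y, v y := by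
    have hl := sum_fiber_mul f q fun z =>
      (∑ y', if f y' = z then v y' else 0) / (∑ y', if f y' = z then q y' else 0)
    have hr := sum_fiber_mul f v fun _ => (1 : ℝ)
    simp only [mul_one] at hr
    simp only [mul_div_assoc]
    rw [← hl, ← hr]
    refine Finset.sum_le_sum fun z _ => ?_
    rcases eq_or_ne (∑ y', if f y' = z then q y' else 0) 0 with h0 | h0
    · rw [h0, zero_mul]
      exact Finset.sum_nonneg fun y _ => by split_ifs <;> simp [hv]
    · rw [mul_div_cancel₀ _ h0]
  rw [Finset.sum_sub_distrib]
  linarith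

lemma mutualInfo_pushChannel_le (p : X → ℝ) (W : X → Y → ℝ) (f : Y → Z) (hp : ∀ x, 0 ≤ p x)
    (hW0 : ∀ x y, 0 ≤ W x y) (hW : ∀ x, ∑ y, W x y = 1) :
    mutualInfo p (pushChannel f W) ≤ mutualInfo p W := by
  set q : Y → ℝ := fun y => ∑ x, p x * W x y with hqdef
  have hq : ∀ y, 0 ≤ q y := fun y => Finset.sum_nonneg fun x _ => mul_nonneg (hp x) (hW0 x y)
  have hQ : ∀ z, ∑ x, p x * pushChannel f W x z = ∑ y, if f y = z then q y else 0 := by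
    intro z
    simp only [pushChannel, Finset.mul_sum, hqdef]
    rw [Finset.sum_comm]
    refine Finset.sum_congr rfl fun y _ => ?_
    split_ifs <;> simp
  have hfib : ∀ v : Y → ℝ, ∑ z, Real.negMulLog (∑ y, if f y = z then v y else 0)
      = -∑ y, v y * Real.log (∑ y', if f y' = f y then v y' else 0) := by
    intro v
    rw [← sum_fiber_mul f v fun z => Real.log (∑ y', if f y' = z then v y' else 0)]
    simp [Real.negMulLog]
  have hgibbs : ∑ x, p x * ∑ y, W x y * (Real.log (q y)
      - Real.log (∑ y', if f y' = f y then q y' else 0)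
      - Real.log (W x y) + Real.log (∑ y', if f y' = f y then W x y' else 0)) ≤ 0 := by
    refine Finset.sum_nonpos fun x _ => ?_
    rcases eq_or_ne (p x) 0 with h0 | h0
    · simp [h0]
    refine mul_nonpos_of_nonneg_of_nonpos (hp x) (sum_mul_log_fiber_le f (hW0 x) hq ?_)
    intro y hy hqy
    have := (Finset.sum_eq_zero_iff_of_nonneg
      fun x _ => mul_nonneg (hp x) (hW0 x y)).1 hqy x (Finset.mem_univ x)
    exact mul_ne_zero h0 hy this
  have hlin : ∀ g : Y → ℝ, ∑ x, p x * ∑ y, W x y * g y = ∑ y, q y * g y := by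
    intro g
    simp only [hqdef, Finset.mul_sum, Finset.sum_mul]
    rw [Finset.sum_comm]
    simp only [mul_assoc]
  simp only [mul_add, mul_sub, Finset.sum_add_distrib, Finset.sum_sub_distrib, hlin] at hgibbs
  rw [mutualInfo_eq p W hW,
    mutualInfo_eq p _ fun x => (sum_pushChannel f W x).trans (hW x)]
  simp only [hQ]
  simp only [pushChannel, hfib]
  simp only [Real.negMulLog, neg_mul, Finset.sum_neg_distrib, mul_neg]
  change _ ≤ -∑ y, q y * Real.log (q y) - _
  linarith

lemma massOn_mul_sum_condOn (p : X → ℝ) (A : Set X) (h : massOn p A ≠ 0) (g : X → ℝ) :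
    massOn p A * ∑ x, condOn p A x * g x = ∑ x, if x ∈ A then p x * g x else 0 := by
  rw [Finset.mul_sum]
  refine Finset.sum_congr rfl fun x _ => ?_
  unfold condOn
  split_ifs
  · field_simp
  · simp

lemma sum_condOn (p : X → ℝ) (A : Set X) (h : massOn p A ≠ 0) : ∑ x, condOn p A x = 1 := by
  have := massOn_mul_sum_condOn p A h fun _ => 1
  simp only [mul_one] at this
  exact mul_left_cancel₀ h (this.trans (mul_one _).symm)

lemma massOn_nonneg {p : X → ℝ} (hp : ∀ x, 0 ≤ p x) (A : Set X) : 0 ≤ massOn p A :=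
  Finset.sum_nonneg fun x _ => by split_ifs <;> simp [hp]

lemma condOn_nonneg {p : X → ℝ} (hp : ∀ x, 0 ≤ p x) (A : Set X) (x : X) : 0 ≤ condOn p A x := by
  unfold condOn
  split_ifs
  · exact div_nonneg (hp x) (massOn_nonneg hp A)
  · exact le_rfl

lemma condOn_pos_iff {p : X → ℝ} {A : Set X} (h : 0 < massOn p A) {x : X} :
    0 < condOn p A x ↔ x ∈ A ∧ 0 < p x := by
  unfold condOn
  split_ifs with hx
  · simp [hx, div_pos_iff_of_pos_right h]
  · simp [hx]

/-- The channel whose rows in `A` are replaced by their common average under `condOn p A`. -/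
def averageOn (p : X → ℝ) (A : Set X) (W : X → Y → ℝ) (x : X) (y : Y) : ℝ :=
  if x ∈ A then ∑ x', condOn p A x' * W x' y else W x y

lemma sum_condOn_mul_row (p : X → ℝ) (A : Set X) (W : X → Y → ℝ) (h : massOn p A ≠ 0)
    (hW : ∀ x, ∑ y, W x y = 1) : ∑ y, ∑ x, condOn p A x * W x y = 1 := by
  rw [Finset.sum_comm]
  simp [← Finset.mul_sum, hW, sum_condOn p A h]

lemma sum_averageOn (p : X → ℝ) (A : Set X) (W : X → Y → ℝ) (h : massOn p A ≠ 0)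
    (hW : ∀ x, ∑ y, W x y = 1) (x : X) : ∑ y, averageOn p A W x y = 1 := by
  unfold averageOn
  split_ifs
  · exact sum_condOn_mul_row p A W h hW
  · exact hW x

lemma sum_mul_ite_mem (p : X → ℝ) (A : Set X) (c : ℝ) (g : X → ℝ) :
    ∑ x, p x * (if x ∈ A then c else g x)
      = massOn p A * c + ∑ x, if x ∈ A then 0 else p x * g x := by
  rw [massOn, Finset.sum_mul, ← Finset.sum_add_distrib]
  refine Finset.sum_congr rfl fun x _ => ?_
  split_ifs <;> simp

lemma sum_ite_mem_add (A : Set X) (g : X → ℝ) :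
    (∑ x, if x ∈ A then g x else 0) + (∑ x, if x ∈ A then 0 else g x) = ∑ x, g x := by
  rw [← Finset.sum_add_distrib]
  refine Finset.sum_congr rfl fun x _ => ?_
  split_ifs <;> simp

/-- Chain rule: splitting off the information conveyed inside the event `A`. -/
lemma mutualInfo_eq_averageOn_add (p : X → ℝ) (A : Set X) (W : X → Y → ℝ)
    (h : massOn p A ≠ 0) (hW : ∀ x, ∑ y, W x y = 1) :
    mutualInfo p W
      = mutualInfo p (averageOn p A W) + massOn p A * mutualInfo (condOn p A) W := by
  have hmarg : ∀ y, ∑ x, p x * averageOn p A W x y = ∑ x, p x * W x y := by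
    intro y
    unfold averageOn
    rw [sum_mul_ite_mem, massOn_mul_sum_condOn p A h, sum_ite_mem_add]
  have hrow : ∀ x, ∑ y, Real.negMulLog (averageOn p A W x y)
      = if x ∈ A then ∑ y, Real.negMulLog (∑ x', condOn p A x' * W x' y)
        else ∑ y, Real.negMulLog (W x y) := by
    intro x
    unfold averageOn
    split_ifs <;> rfl
  rw [mutualInfo_eq p W hW, mutualInfo_eq _ _ (sum_averageOn p A W h hW),
    mutualInfo_eq _ W hW, mul_sub, massOn_mul_sum_condOn p A h]
  simp only [hmarg, hrow]
  rw [sum_mul_ite_mem, ← sum_ite_mem_add A fun x => p x * ∑ y, Real.negMulLog (W x y)]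
  ring

lemma massOn_mul_mutualInfo_condOn_le (p : X → ℝ) (A : Set X) (W : X → Y → ℝ)
    (hp : ∀ x, 0 ≤ p x) (hp1 : ∑ x, p x = 1) (h : massOn p A ≠ 0)
    (hW0 : ∀ x y, 0 ≤ W x y) (hW : ∀ x, ∑ y, W x y = 1) :
    massOn p A * mutualInfo (condOn p A) W ≤ mutualInfo p W := by
  rw [mutualInfo_eq_averageOn_add p A W h hW]
  refine le_add_of_nonneg_left (mutualInfo_nonneg p _ hp hp1 (fun x y => ?_)
    (sum_averageOn p A W h hW))
  unfold averageOn
  split_ifs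
  · exact Finset.sum_nonneg fun x _ => mul_nonneg (condOn_nonneg hp A x) (hW0 x y)
  · exact hW0 x y

lemma mutualInfo_condOn_congr (p : X → ℝ) (A : Set X) {W W' : X → Y → ℝ}
    (hWW' : ∀ x ∈ A, W x = W' x) :
    mutualInfo (condOn p A) W = mutualInfo (condOn p A) W' := by
  have h : ∀ x y, condOn p A x * W x y = condOn p A x * W' x y := by
    intro x y
    by_cases hx : x ∈ A
    · rw [hWW' x hx]
    · simp [condOn, hx]
  simp only [mutualInfo, h]

/-- The channel agreeing with `W` on `A` and emitting the output law of `W` under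
`condOn p A` off `A`. -/
def extendOff (p : X → ℝ) (A : Set X) (W : X → Y → ℝ) (x : X) (y : Y) : ℝ :=
  if x ∈ A then W x y else ∑ x', condOn p A x' * W x' y

lemma sum_extendOff (p : X → ℝ) (A : Set X) (W : X → Y → ℝ) (h : massOn p A ≠ 0)
    (hW : ∀ x, ∑ y, W x y = 1) (x : X) : ∑ y, extendOff p A W x y = 1 := by
  unfold extendOff
  split_ifs
  · exact hW x
  · exact sum_condOn_mul_row p A W h hW

lemma mutualInfo_extendOff (p : X → ℝ) (A : Set X) (W : X → Y → ℝ) (hp1 : ∑ x, p x = 1)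
    (h : massOn p A ≠ 0) (hW : ∀ x, ∑ y, W x y = 1) :
    mutualInfo p (extendOff p A W) = massOn p A * mutualInfo (condOn p A) W := by
  have hA : ∀ x ∈ A, extendOff p A W x = W x := by
    intro x hx
    funext y
    simp [extendOff, hx]
  have hmarg : ∀ y, ∑ x, condOn p A x * extendOff p A W x y = ∑ x, condOn p A x * W x y := by
    intro y
    refine Finset.sum_congr rfl fun x _ => ?_
    by_cases hx : x ∈ A
    · rw [hA x hx]
    · simp [condOn, hx]
  have havg : averageOn p A (extendOff p A W) = fun _ y => ∑ x, condOn p A x * W x y := by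
    funext x y
    by_cases hx : x ∈ A
    · simp [averageOn, hx, hmarg]
    · simp [averageOn, extendOff, hx]
  rw [mutualInfo_eq_averageOn_add p A _ h (sum_extendOff p A W h hW), havg,
    mutualInfo_const p _ hp1 (sum_condOn_mul_row p A W h hW), zero_add,
    mutualInfo_condOn_congr p A hA]

end MutualInformation

section Closure

variable {Cn : Set 𝕊 → Set 𝕊}

omit [Fintype 𝕊] in
lemma atomCore_spec (hrefl : ∀ Γ : Set 𝕊, Γ ⊆ Cn Γ)
    (hmono : ∀ Γ Γ' : Set 𝕊, Γ ⊆ Γ' → Cn Γ ⊆ Cn Γ')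
    (hidem : ∀ Γ : Set 𝕊, Cn (Cn Γ) = Cn Γ) (L : List 𝕊) (S : Set 𝕊) :
    atomCore Cn S L ⊆ S ∧ S ⊆ Cn (atomCore Cn S L) := by
  induction L generalizing S with
  | nil => exact ⟨subset_rfl, hrefl S⟩
  | cons s L ih =>
    obtain ⟨h₁, h₂⟩ := ih (atomStep Cn S s)
    change atomCore Cn (atomStep Cn S s) L ⊆ S ∧ S ⊆ Cn (atomCore Cn (atomStep Cn S s) L)
    have hstep : atomStep Cn S s ⊆ S ∧ S ⊆ Cn (atomStep Cn S s) := by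
      unfold atomStep
      split_ifs with hs
      · refine ⟨Set.sdiff_subset, fun t ht => ?_⟩
        by_cases hts : t = s
        · exact hts ▸ hs
        · exact hrefl _ ⟨ht, hts⟩
      · exact ⟨subset_rfl, hrefl S⟩
    refine ⟨h₁.trans hstep.1, hstep.2.trans ?_⟩
    exact (hmono _ _ h₂).trans (hidem _).subset

omit [Fintype 𝕊] in
lemma mem_Cn_of_Cn_insert_eq (hrefl : ∀ Γ : Set 𝕊, Γ ⊆ Cn Γ) {S : Set 𝕊} {s t : 𝕊}
    (h : Cn ((S \ {s}) ∪ {t}) = Cn S) : t ∈ Cn S :=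
  h ▸ hrefl _ (Or.inr rfl)

omit [Fintype 𝕊] in
lemma Cn_replace_eq_of_notMem_core (hrefl : ∀ Γ : Set 𝕊, Γ ⊆ Cn Γ)
    (hmono : ∀ Γ Γ' : Set 𝕊, Γ ⊆ Γ' → Cn Γ ⊆ Cn Γ')
    (hidem : ∀ Γ : Set 𝕊, Cn (Cn Γ) = Cn Γ) {S A : Set 𝕊} (hAS : A ⊆ S) (hSA : S ⊆ Cn A)
    {s t : 𝕊} (hs : s ∉ A) (ht : t ∈ Cn S) : Cn ((S \ {s}) ∪ {t}) = Cn S := by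
  apply Set.Subset.antisymm
  · refine (hmono _ (Cn S) ?_).trans (hidem S).subset
    rintro u (hu | rfl)
    · exact hrefl _ hu.1
    · exact ht
  · refine (hmono _ _ (hSA.trans (hmono A ((S \ {s}) ∪ {t}) ?_))).trans (hidem _).subset
    exact fun a ha => Or.inl ⟨hAS ha, fun h => hs (h ▸ ha)⟩

end Closure

section ZeroDistortion

variable {Cn : Set 𝕊 → Set 𝕊} {S_O Shat_O A : Set 𝕊} {p : 𝕊 → ℝ}

lemma RsemZero_eq_zero (hp0 : ∀ s, 0 ≤ p s) (hp1 : ∑ s, p s = 1) {t : 𝕊} (ht : t ∈ Shat_O)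
    (hdist : ∀ s, 0 < p s → Cn ((S_O \ {s}) ∪ {t}) = Cn S_O) :
    RsemZero Cn S_O Shat_O p = 0 := by
  apply le_antisymm
  · refine sInf_le ⟨fun _ y => if y = t then 1 else 0, ⟨?_, ?_, ?_⟩, ?_, ?_⟩
    · intro x y
      dsimp only
      split_ifs <;> norm_num
    · simp
    · intro x y hy
      have : y = t := by simpa using hy
      exact this ▸ ht
    · intro s hs y hy
      have : y = t := by
        by_contra hne
        simp [hne] at hy
      exact this ▸ hdist s hs
    · rw [mutualInfo_const p _ hp1 (by simp)]
      rfl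
  · refine le_sInf ?_
    rintro _ ⟨W, hW, -, rfl⟩
    exact_mod_cast mutualInfo_nonneg p W hp0 hp1 hW.1 hW.2.1

lemma massOn_mul_hypergraphEntropy_le (hp0 : ∀ s, 0 ≤ p s) (hp1 : ∑ s, p s = 1)
    (hA : A.Nonempty) (hP : 0 < massOn p A) :
    (massOn p A : EReal) * hypergraphEntropy (condOn p A) A (coreHypergraph Cn S_O Shat_O A)
      ≤ RsemZero Cn S_O Shat_O p := by
  obtain ⟨a₀, ha₀⟩ := hA
  refine le_sInf ?_
  rintro _ ⟨W, ⟨hW0, hW1, hWS⟩, hdist, rfl⟩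
  let conf : 𝕊 → Finset 𝕊 := fun y => {a | a ∈ A ∧ y ∈ RCn Cn S_O Shat_O a}
  let f : 𝕊 → Finset 𝕊 := fun y => if (conf y).Nonempty then conf y else {a₀}
  have hf : ∀ y, (f y).Nonempty ∧ ↑(f y) ⊆ A := by
    intro y
    by_cases h : (conf y).Nonempty
    · simp only [f, if_pos h]
      refine ⟨h, fun a ha => ?_⟩
      simp only [conf, Finset.coe_filter, Finset.mem_univ, true_and, Set.mem_ofPred_eq] at ha
      exact ha.1
    · simp [f, if_neg h, ha₀]
  have hK : hypergraphEntropy (condOn p A) A (coreHypergraph Cn S_O Shat_O A)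
      ≤ (mutualInfo (condOn p A) (pushChannel f W) : ℝ) := by
    refine sInf_le ⟨pushChannel f W, ⟨pushChannel_nonneg f hW0,
      fun x => (sum_pushChannel f W x).trans (hW1 x), ?_⟩, ?_, rfl⟩
    · intro x w hw
      obtain ⟨y, rfl, -⟩ := exists_of_pushChannel_ne_zero hw
      exact hf y
    · intro a ha w hw
      obtain ⟨haA, hpa⟩ := (condOn_pos_iff hP).1 ha
      obtain ⟨y, rfl, hy⟩ := exists_of_pushChannel_ne_zero hw.ne'
      have hya : y ∈ RCn Cn S_O Shat_O a :=
        ⟨hWS a y hy, hdist a hpa y (lt_of_le_of_ne (hW0 a y) hy.symm)⟩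
      have hac : a ∈ conf y := by simp [conf, haA, hya]
      have hfy : f y = conf y := if_pos ⟨a, hac⟩
      refine ⟨hfy ▸ hac, (hf y).1, (hf y).2, y, fun b hb => ?_⟩
      rw [hfy] at hb
      simp only [conf, Finset.mem_filter] at hb
      exact hb.2.2
  refine (mul_le_mul_of_nonneg_left hK (by exact_mod_cast hP.le)).trans ?_
  have hle := (mul_le_mul_of_nonneg_left
    (mutualInfo_pushChannel_le (condOn p A) W f (condOn_nonneg hp0 A) hW0 hW1) hP.le).trans
    (massOn_mul_mutualInfo_condOn_le p A W hp0 hp1 hP.ne' hW0 hW1)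
  exact_mod_cast hle

lemma RsemZero_le_massOn_mul_hypergraphEntropy (hp0 : ∀ s, 0 ≤ p s) (hp1 : ∑ s, p s = 1)
    (hP : 0 < massOn p A) (hShat : Shat_O.Nonempty)
    (hoff : ∀ s ∉ A, ∀ a ∈ A, ∀ t ∈ RCn Cn S_O Shat_O a, Cn ((S_O \ {s}) ∪ {t}) = Cn S_O) :
    RsemZero Cn S_O Shat_O p ≤
      (massOn p A : EReal) *
        hypergraphEntropy (condOn p A) A (coreHypergraph Cn S_O Shat_O A) := by
  obtain ⟨t₀, ht₀⟩ := hShat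
  rw [← EReal.div_le_iff_le_mul (by exact_mod_cast hP) (EReal.coe_ne_top _)]
  refine le_sInf ?_
  rintro _ ⟨K, ⟨hK0, hK1, -⟩, hKΓ, rfl⟩
  rw [EReal.div_le_iff_le_mul (by exact_mod_cast hP) (EReal.coe_ne_top _)]
  let f : Finset 𝕊 → 𝕊 := fun w =>
    if h : w ∈ coreHypergraph Cn S_O Shat_O A then h.2.2.choose else t₀
  have hfR : ∀ w ∈ coreHypergraph Cn S_O Shat_O A, ∀ a ∈ w, f w ∈ RCn Cn S_O Shat_O a := by
    intro w hw
    simp only [f, dif_pos hw]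
    exact hw.2.2.choose_spec
  have hfS : ∀ w, f w ∈ Shat_O := by
    intro w
    by_cases hw : w ∈ coreHypergraph Cn S_O Shat_O A
    · obtain ⟨a, ha⟩ := hw.1
      exact (hfR w hw a ha).1
    · simpa only [f, dif_neg hw] using ht₀
  set V := pushChannel f K
  have hV0 : ∀ x y, 0 ≤ V x y := pushChannel_nonneg f hK0
  have hV1 : ∀ x, ∑ y, V x y = 1 := fun x => (sum_pushChannel f K x).trans (hK1 x)
  have hVS : ∀ x y, V x y ≠ 0 → y ∈ Shat_O := by
    intro x y hy
    obtain ⟨w, rfl, -⟩ := exists_of_pushChannel_ne_zero hy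
    exact hfS w
  have hVR : ∀ a, 0 < condOn p A a → ∀ y, V a y ≠ 0 → y ∈ RCn Cn S_O Shat_O a := by
    intro a ha y hy
    obtain ⟨w, rfl, hw⟩ := exists_of_pushChannel_ne_zero hy
    obtain ⟨haw, hwΓ⟩ := hKΓ a ha w (lt_of_le_of_ne (hK0 a w) hw.symm)
    exact hfR w hwΓ a haw
  have houtput : ∀ y, ∑ a, condOn p A a * V a y ≠ 0 → ∃ a, 0 < condOn p A a ∧ V a y ≠ 0 := by
    intro y hy
    obtain ⟨a, -, ha⟩ := Finset.exists_ne_zero_of_sum_ne_zero hy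
    exact ⟨a, lt_of_le_of_ne (condOn_nonneg hp0 A a) (left_ne_zero_of_mul ha).symm,
      right_ne_zero_of_mul ha⟩
  have hW : RsemZero Cn S_O Shat_O p ≤ (mutualInfo p (extendOff p A V) : ℝ) := by
    refine sInf_le ⟨extendOff p A V, ⟨?_, sum_extendOff p A V hP.ne' hV1, ?_⟩, ?_, rfl⟩
    · intro x y
      unfold extendOff
      split_ifs
      · exact hV0 x y
      · exact Finset.sum_nonneg fun a _ => mul_nonneg (condOn_nonneg hp0 A a) (hV0 a y)
    · intro x y hy
      unfold extendOff at hy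
      split_ifs at hy
      · exact hVS x y hy
      · obtain ⟨a, -, ha⟩ := houtput y hy
        exact hVS a y ha
    · intro s hs y hy
      unfold extendOff at hy
      split_ifs at hy with hsA
      · exact (hVR s ((condOn_pos_iff hP).2 ⟨hsA, hs⟩) y hy.ne').2
      · obtain ⟨a, ha, hay⟩ := houtput y hy.ne'
        exact hoff s hsA a ((condOn_pos_iff hP).1 ha).1 y (hVR a ha y hay)
  refine hW.trans ?_
  rw [mutualInfo_extendOff p A V hp1 hP.ne' hV1]
  exact_mod_cast mul_le_mul_of_nonneg_left
    (mutualInfo_pushChannel_le (condOn p A) K f (condOn_nonneg hp0 A) hK0 hK1) hP.le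

end ZeroDistortion

/-- Confusable-core zero-distortion rate via hypergraph
entropy: under core coverage, `R_sem(0) = P_A · H_{Γ_0}(π_A)`, with the
convention that the right-hand side is `0` when `P_A = 0`. -/
theorem confusable_hypergraph_exact
    (Cn : Set 𝕊 → Set 𝕊)
    (hrefl : ∀ Γ : Set 𝕊, Γ ⊆ Cn Γ)
    (hmono : ∀ Γ Γ' : Set 𝕊, Γ ⊆ Γ' → Cn Γ ⊆ Cn Γ')
    (hidem : ∀ Γ : Set 𝕊, Cn (Cn Γ) = Cn Γ)
    (S_O Shat_O : Set 𝕊) (L : List 𝕊)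
    (hnodup : L.Nodup)
    (henum : ∀ s : 𝕊, s ∈ L ↔ s ∈ S_O)
    (p : 𝕊 → ℝ) (hp : IsProbVector p S_O)
    (hAne : (atomCore Cn S_O L).Nonempty)
    (hcover :
      (massOn p (atomCore Cn S_O L) = 0 ∧ (Shat_O ∩ Cn S_O).Nonempty) ∨
      (0 < massOn p (atomCore Cn S_O L) ∧
        ∀ a ∈ atomCore Cn S_O L, (RCn Cn S_O Shat_O a).Nonempty)) :
    (massOn p (atomCore Cn S_O L) = 0 → RsemZero Cn S_O Shat_O p = 0) ∧
    (0 < massOn p (atomCore Cn S_O L) →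
      RsemZero Cn S_O Shat_O p =
        ((massOn p (atomCore Cn S_O L) : ℝ) : EReal) *
          hypergraphEntropy (condOn p (atomCore Cn S_O L))
            (atomCore Cn S_O L)
            (coreHypergraph Cn S_O Shat_O (atomCore Cn S_O L))) := by
  obtain ⟨hAS, hSA⟩ := atomCore_spec hrefl hmono hidem L S_O
  set A := atomCore Cn S_O L
  obtain ⟨hp0, hp1, -⟩ := hp
  have hoff : ∀ s ∉ A, ∀ t ∈ Cn S_O, Cn ((S_O \ {s}) ∪ {t}) = Cn S_O := fun s hs t ht =>
    Cn_replace_eq_of_notMem_core hrefl hmono hidem hAS hSA hs ht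
  constructor
  · intro hP
    rcases hcover with ⟨-, t, htS, htC⟩ | ⟨hP', -⟩
    · refine RsemZero_eq_zero hp0 hp1 htS fun s hs => hoff s (fun hsA => ?_) t htC
      have := (Finset.sum_eq_zero_iff_of_nonneg fun x _ => by
        split_ifs <;> simp [hp0]).1 hP s (Finset.mem_univ s)
      rw [if_pos hsA] at this
      exact hs.ne' this
    · exact absurd hP hP'.ne'
  · intro hP
    rcases hcover with ⟨hP', -⟩ | ⟨-, hR⟩
    · exact absurd hP' hP.ne'
    · obtain ⟨a₀, ha₀⟩ := hAne
      obtain ⟨t₀, ht₀⟩ := hR a₀ ha₀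
      exact le_antisymm
        (RsemZero_le_massOn_mul_hypergraphEntropy hp0 hp1 hP ⟨t₀, ht₀.1⟩
          fun s hs a _ t ht => hoff s hs t (mem_Cn_of_Cn_insert_eq hrefl ht.2))
        (massOn_mul_hypergraphEntropy_le hp0 hp1 ⟨a₀, ha₀⟩ hP)

end
end
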